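/- Let ν > 0, θ > 0, σ ∈ ℝ. Define the modified Bessel function of the second kind K_ν(z) = ∫_0^∞ e^{−z cosh t} cosh(ν t) dt for z > 0, and define the one-dimensional Matérn kernel M_ν(x) = (σ² 2^{1−ν} / Γ(ν)) · ((√(2ν)/θ)|x|)^ν · K_ν((√(2ν)/θ)|x|) for x ≠ 0 (with any value at x = 0). Then for every ξ ∈ ℝ, the Fourier transform of M_ν is 𝓕M_ν(ξ) = (2π)^{-1/2} ∫_ℝ e^{-iξx} M_ν(x) dx = (θ σ² Γ(ν + 1/2)) / (√ν Γ(ν)) · (1 + θ² ξ² / (2ν))^{−(ν + 1/2)}. -/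

import Mathlib

open MeasureTheory Real

/-- The modified Bessel function of the second kind,
K_ν(z) = ∫_0^∞ e^{−z cosh t} cosh(ν t) dt for z > 0. -/
noncomputable def besselK (ν z : ℝ) : ℝ :=
  ∫ t in Set.Ioi (0 : ℝ), Real.exp (-z * Real.cosh t) * Real.cosh (ν * t)

lemma mat_int {ν : ℝ} (hν : 0 < ν) (z : ℝ) :
    IntegrableOn (fun u : ℝ => u ^ (ν - 1) * Real.exp (-u - z ^ 2 / (4 * u))) (Set.Ioi 0) := by
  refine Integrable.mono' (Real.GammaIntegral_convergent hν) ?_ ?_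
  · exact Measurable.aestronglyMeasurable (by fun_prop)
  · refine (ae_restrict_iff' measurableSet_Ioi).mpr (ae_of_all _ fun u hu => ?_)
    have hu : 0 < u := hu
    rw [Real.norm_of_nonneg (by positivity), mul_comm]
    gcongr
    have : 0 ≤ z ^ 2 / (4 * u) := by positivity
    linarith

lemma mat_bessel {ν z : ℝ} (hν : 0 < ν) (hz : 0 < z) :
    z ^ ν * besselK ν z = 2 ^ (ν - 1) *
      ∫ u in Set.Ioi (0 : ℝ), u ^ (ν - 1) * Real.exp (-u - z ^ 2 / (4 * u)) := by
  have himg : (fun t : ℝ => z / 2 * Real.exp t) '' Set.univ = Set.Ioi 0 := by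
    ext u
    constructor
    · rintro ⟨t, -, rfl⟩
      exact Set.mem_Ioi.2 (by positivity)
    · intro hu
      have hu : 0 < u := hu
      refine ⟨Real.log (2 * u / z), trivial, ?_⟩
      simp only
      rw [Real.exp_log (by positivity)]
      field_simp
  have hder : ∀ t ∈ (Set.univ : Set ℝ),
      HasDerivWithinAt (fun t : ℝ => z / 2 * Real.exp t) (z / 2 * Real.exp t) Set.univ t :=
    fun t _ => ((Real.hasDerivAt_exp t).const_mul _).hasDerivWithinAt
  have hinj : Set.InjOn (fun t : ℝ => z / 2 * Real.exp t) Set.univ := by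
    intro s _ t _ h
    have h : z / 2 * Real.exp s = z / 2 * Real.exp t := h
    exact Real.exp_injective (mul_left_cancel₀ (by positivity) h)
  have hpt : ∀ t : ℝ, |z / 2 * Real.exp t| • ((z / 2 * Real.exp t) ^ (ν - 1) *
      Real.exp (-(z / 2 * Real.exp t) - z ^ 2 / (4 * (z / 2 * Real.exp t)))) =
      (z / 2) ^ ν * (Real.exp (-z * Real.cosh t) * Real.exp (ν * t)) := by
    intro t
    have hp : 0 < z / 2 * Real.exp t := by positivity
    rw [abs_of_pos hp, smul_eq_mul, ← mul_assoc, mul_comm (z / 2 * Real.exp t),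
      ← Real.rpow_add_one hp.ne', sub_add_cancel, Real.mul_rpow (by positivity) (by positivity),
      ← Real.exp_mul, mul_comm t ν, mul_assoc, mul_comm (Real.exp (ν * t))]
    congr 3
    rw [Real.cosh_eq, Real.exp_neg]
    field_simp
    ring
  have hI := mat_int hν z
  rw [← himg, integrableOn_image_iff_integrableOn_abs_deriv_smul MeasurableSet.univ hder hinj] at hI
  simp only [hpt] at hI
  rw [integrableOn_univ] at hI
  have hc : (z / 2) ^ ν ≠ 0 := by positivity
  have hF : Integrable (fun t => Real.exp (-z * Real.cosh t) * Real.exp (ν * t)) := by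
    have := hI.const_mul ((z / 2) ^ ν)⁻¹
    simpa only [inv_mul_cancel_left₀ hc] using this
  rw [← himg, integral_image_eq_integral_abs_deriv_smul MeasurableSet.univ hder hinj]
  simp only [hpt]
  rw [setIntegral_univ, integral_const_mul,
    ← intervalIntegral.integral_Iic_add_Ioi (b := 0) hF.integrableOn hF.integrableOn]
  have hneg : ∫ t in Set.Iic (0:ℝ), Real.exp (-z * Real.cosh t) * Real.exp (ν * t) =
      ∫ t in Set.Ioi (0:ℝ), Real.exp (-z * Real.cosh t) * Real.exp (-(ν * t)) := by
    have := integral_comp_neg_Ioi (0:ℝ) (fun t => Real.exp (-z * Real.cosh t) * Real.exp (ν * t))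
    simp only [Real.cosh_neg, mul_neg, neg_zero] at this
    exact this.symm
  have hFn : Integrable (fun t => Real.exp (-z * Real.cosh t) * Real.exp (-(ν * t))) := by
    simpa only [Real.cosh_neg, mul_neg] using hF.comp_neg
  rw [hneg, ← integral_add hFn.integrableOn hF.integrableOn]
  have hK : ∫ t in Set.Ioi (0:ℝ), (Real.exp (-z * Real.cosh t) * Real.exp (-(ν * t)) +
      Real.exp (-z * Real.cosh t) * Real.exp (ν * t)) = 2 * besselK ν z := by
    unfold besselK
    rw [← integral_const_mul]
    congr 1 with t
    rw [Real.cosh_eq (ν * t)]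
    ring
  rw [hK, Real.div_rpow hz.le zero_le_two, Real.rpow_sub_one two_ne_zero]
  field_simp

lemma mat_gauss {ν a u : ℝ} (ha : 0 < a) (hu : 0 < u) (ξ : ℝ) :
    ∫ x : ℝ, Complex.exp (-Complex.I * (ξ * x)) *
      ((u ^ (ν - 1) * Real.exp (-u - (a * |x|) ^ 2 / (4 * u)) : ℝ) : ℂ) =
    ((2 * √π / a * (u ^ (ν + 1 / 2 - 1) * Real.exp (-((1 + ξ ^ 2 / a ^ 2) * u))) : ℝ) : ℂ) := by
  have hb : 0 < a ^ 2 / (4 * u) := by positivity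
  have h := fourierIntegral_gaussian (b := ((a ^ 2 / (4 * u) : ℝ) : ℂ))
    (by rw [Complex.ofReal_re]; exact hb) (-ξ : ℂ)
  have hL : ∀ x : ℝ, Complex.exp (-Complex.I * (ξ * x)) *
      ((u ^ (ν - 1) * Real.exp (-u - (a * |x|) ^ 2 / (4 * u)) : ℝ) : ℂ) =
      ((u ^ (ν - 1) * Real.exp (-u) : ℝ) : ℂ) * (Complex.exp (Complex.I * (-ξ : ℂ) * x) *
        Complex.exp (-((a ^ 2 / (4 * u) : ℝ) : ℂ) * x ^ 2)) := by
    intro x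
    have e1 : -u - (a * |x|) ^ 2 / (4 * u) = -u + -(a ^ 2 / (4 * u)) * x ^ 2 := by
      rw [mul_pow, sq_abs]; ring
    rw [e1, Real.exp_add]
    push_cast
    ring_nf
  simp only [hL]
  rw [integral_const_mul, h]
  have h2 : ((π : ℂ) / ((a ^ 2 / (4 * u) : ℝ) : ℂ)) ^ (1 / 2 : ℂ) =
      ((2 * √π / a * u ^ (1 / 2 : ℝ) : ℝ) : ℂ) := by
    have : (π / (a ^ 2 / (4 * u))) ^ (1 / 2 : ℝ) = 2 * √π / a * u ^ (1 / 2 : ℝ) := by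
      rw [← Real.sqrt_eq_rpow, ← Real.sqrt_eq_rpow]
      rw [show π / (a ^ 2 / (4 * u)) = (2 / a) ^ 2 * (π * u) by field_simp; ring,
        Real.sqrt_mul (by positivity), Real.sqrt_sq (by positivity),
        Real.sqrt_mul (by positivity)]
      ring
    rw [← this, Complex.ofReal_cpow (by positivity)]
    push_cast
    rfl
  have h3 : Complex.exp (-(-ξ : ℂ) ^ 2 / (4 * ((a ^ 2 / (4 * u) : ℝ) : ℂ))) =
      ((Real.exp (-(ξ ^ 2 / a ^ 2 * u)) : ℝ) : ℂ) := by
    rw [Complex.ofReal_exp]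
    congr 1
    have : (a : ℂ) ≠ 0 := by exact_mod_cast ha.ne'
    have : (u : ℂ) ≠ 0 := by exact_mod_cast hu.ne'
    push_cast
    field_simp
  rw [h2, h3, ← Complex.ofReal_mul, ← Complex.ofReal_mul, Complex.ofReal_inj,
    show ν + 1 / 2 - 1 = (ν - 1) + 1 / 2 by ring, Real.rpow_add hu,
    show -((1 + ξ ^ 2 / a ^ 2) * u) = -u + -(ξ ^ 2 / a ^ 2 * u) by ring, Real.exp_add]
  ring

lemma mat_prod {ν a : ℝ} (hν : 0 < ν) (ha : 0 < a) (ξ : ℝ) :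
    Integrable (Function.uncurry fun x u : ℝ => Complex.exp (-Complex.I * (ξ * x)) *
      ((u ^ (ν - 1) * Real.exp (-u - (a * |x|) ^ 2 / (4 * u)) : ℝ) : ℂ))
      ((volume : Measure ℝ).prod (volume.restrict (Set.Ioi (0:ℝ)))) := by
  have hn : ∀ x u : ℝ, 0 < u → ‖Complex.exp (-Complex.I * (ξ * x)) *
      ((u ^ (ν - 1) * Real.exp (-u - (a * |x|) ^ 2 / (4 * u)) : ℝ) : ℂ)‖ =
      u ^ (ν - 1) * Real.exp (-u) * Real.exp (-(a ^ 2 / (4 * u)) * x ^ 2) := by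
    intro x u hu
    rw [norm_mul, Complex.norm_exp, Complex.norm_real, Real.norm_of_nonneg (by positivity),
      mul_assoc, ← Real.exp_add, mul_pow, sq_abs]
    simp
    left
    ring
  have hm : Measurable (Function.uncurry fun x u : ℝ => Complex.exp (-Complex.I * (ξ * x)) *
      ((u ^ (ν - 1) * Real.exp (-u - (a * |x|) ^ 2 / (4 * u)) : ℝ) : ℂ)) := by
    unfold Function.uncurry
    fun_prop
  rw [integrable_prod_iff' hm.aestronglyMeasurable]
  constructor
  · refine (ae_restrict_iff' measurableSet_Ioi).mpr (ae_of_all _ fun u hu => ?_)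
    have hu : 0 < u := hu
    have hb : 0 < a ^ 2 / (4 * u) := by positivity
    refine Integrable.mono' ((integrable_exp_neg_mul_sq hb).const_mul
      (u ^ (ν - 1) * Real.exp (-u))) ?_ (ae_of_all _ fun x => (hn x u hu).le)
    exact (hm.comp (measurable_id.prodMk measurable_const)).aestronglyMeasurable
  · have hG := (Real.GammaIntegral_convergent (s := ν + 1 / 2) (by positivity)).const_mul (2 * √π / a)
    refine hG.congr ((ae_restrict_iff' measurableSet_Ioi).mpr (ae_of_all _ fun u hu => ?_))
    have hu : 0 < u := hu
    simp only [Function.uncurry, hn _ u hu]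
    rw [integral_const_mul, integral_gaussian,
      show π / (a ^ 2 / (4 * u)) = (2 / a) ^ 2 * (π * u) by field_simp; ring,
        Real.sqrt_mul (by positivity), Real.sqrt_sq (by positivity),
        Real.sqrt_mul (by positivity), Real.sqrt_eq_rpow u,
        show ν + 1 / 2 - 1 = (ν - 1) + 1 / 2 by ring, Real.rpow_add hu]
    ring

/-- The Fourier transform (spectral density) of the one-dimensional Matérn kernel
M_ν(x) = (σ² 2^{1−ν}/Γ(ν)) ((√(2ν)/θ)|x|)^ν K_ν((√(2ν)/θ)|x|):
𝓕M_ν(ξ) = (θ σ² Γ(ν+1/2))/(√ν Γ(ν)) (1 + θ²ξ²/(2ν))^{−(ν+1/2)}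
(second formula in equation (3.11) of the paper). -/
theorem fourier_matern (ν θ σ : ℝ) (hν : 0 < ν) (hθ : 0 < θ)
    (M : ℝ → ℝ)
    (hM : ∀ x : ℝ, x ≠ 0 →
      M x = σ ^ 2 * (2 : ℝ) ^ ((1 : ℝ) - ν) / Real.Gamma ν *
        ((Real.sqrt (2 * ν) / θ * |x|) ^ ν *
          besselK ν (Real.sqrt (2 * ν) / θ * |x|))) :
    ∀ ξ : ℝ,
      ((2 * π : ℝ) ^ (-(1 : ℝ) / 2) : ℝ) *
          ∫ x : ℝ, Complex.exp (-Complex.I * (ξ * x)) * (M x : ℂ) =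
        ((θ * σ ^ 2 * Real.Gamma (ν + 1 / 2) / (Real.sqrt ν * Real.Gamma ν) *
          (1 + θ ^ 2 * ξ ^ 2 / (2 * ν)) ^ (-(ν + 1 / 2)) : ℝ) : ℂ) := by
  intro ξ
  set a : ℝ := Real.sqrt (2 * ν) / θ with ha_def
  have ha : 0 < a := by positivity
  have hΓ : 0 < Real.Gamma ν := Real.Gamma_pos_of_pos hν
  have hae : (fun x : ℝ => Complex.exp (-Complex.I * (ξ * x)) * (M x : ℂ)) =ᵐ[volume]
      fun x : ℝ => ((σ ^ 2 / Real.Gamma ν : ℝ) : ℂ) * ∫ u in Set.Ioi (0:ℝ),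
        Complex.exp (-Complex.I * (ξ * x)) *
        ((u ^ (ν - 1) * Real.exp (-u - (a * |x|) ^ 2 / (4 * u)) : ℝ) : ℂ) := by
    filter_upwards [Measure.ae_ne volume (0:ℝ)] with x hx
    have hax : 0 < a * |x| := by positivity
    rw [hM x hx, mat_bessel hν hax, integral_const_mul, integral_complex_ofReal]
    have : (2:ℝ) ^ (1 - ν) * 2 ^ (ν - 1) = 1 := by
      rw [← Real.rpow_add two_pos]; simp
    rw [show ∀ I : ℝ, σ ^ 2 * (2:ℝ) ^ (1 - ν) / Real.Gamma ν * (2 ^ (ν - 1) * I) =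
      σ ^ 2 / Real.Gamma ν * I * ((2:ℝ) ^ (1 - ν) * 2 ^ (ν - 1)) by intro I; ring, this]
    push_cast
    ring
  rw [integral_congr_ae hae, integral_const_mul, integral_integral_swap (mat_prod hν ha ξ),
    setIntegral_congr_fun measurableSet_Ioi (fun u hu => mat_gauss ha hu ξ),
    integral_complex_ofReal, integral_const_mul,
    Real.integral_rpow_mul_exp_neg_mul_Ioi (by positivity) (by positivity),
    ← Complex.ofReal_mul, ← Complex.ofReal_mul, Complex.ofReal_inj]
  have ha2 : ξ ^ 2 / a ^ 2 = θ ^ 2 * ξ ^ 2 / (2 * ν) := by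
    rw [ha_def, div_pow, Real.sq_sqrt (by positivity)]
    field_simp
  rw [ha2, one_div, Real.inv_rpow (by positivity), ← Real.rpow_neg (by positivity),
    neg_div, Real.rpow_neg (by positivity), ← Real.sqrt_eq_rpow, ha_def,
    Real.sqrt_mul (by positivity), Real.sqrt_mul (by positivity)]
  have h2 : √2 * √2 = 2 := Real.mul_self_sqrt (by positivity)
  field_simp
  linear_combination (-σ ^ 2) * h2
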